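/- arXiv:1603.09252 — 7 statements merged into one kernel-verified Lean document; each statement's English description precedes it below -/
import Mathlib

section
/- Let d ≥ 1, γ > 0, τ ≥ 0 and s ∈ ℝ, let X be a complex normed vector space, and let ω ∈ ℝ^d be (γ, τ)-diophantine. Let g : ℤ^d → X satisfy g_0 = 0 and ‖g‖_{s+τ} < ∞. Define f : ℤ^d → X by f_0 := 0 and f_ℓ := (i ω·ℓ)^{-1} • g_ℓ for ℓ ≠ 0 (the Fourier coefficients of the solution of ω·∂_φ f = g). Then ‖f‖_s ≤ γ^{-1} ‖g‖_{s+τ}. -/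
open scoped ENNReal

/-- `⟨ℓ⟩ := max (1, |ℓ₁| + … + |ℓ_d|)` for `ℓ ∈ ℤ^d`. -/
noncomputable def zbracket {d : ℕ} (ℓ : Fin d → ℤ) : ℝ :=
  max 1 (∑ i, |(ℓ i : ℝ)|)

/-- The `H^s` Sobolev norm (valued in `[0,∞]`) of a family `c : ℤ^d → X`. -/
noncomputable def sobNorm (d : ℕ) (s : ℝ) {X : Type*} [NormedAddCommGroup X]
    (c : (Fin d → ℤ) → X) : ℝ≥0∞ :=
  (∑' ℓ : Fin d → ℤ, ENNReal.ofReal (zbracket ℓ ^ (2 * s) * ‖c ℓ‖ ^ 2)) ^ (1 / 2 : ℝ)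

universe u

/-- The length `|ℓ₁| + … + |ℓ_d|` of a nonzero `ℓ ∈ ℤ^d` is at least `1`. -/
theorem one_le_sum_abs {d : ℕ} {ℓ : Fin d → ℤ} (h : ℓ ≠ 0) :
    1 ≤ ∑ i, |(ℓ i : ℝ)| := by
  obtain ⟨j, hj⟩ := Function.ne_iff.mp h
  calc (1 : ℝ) ≤ |(ℓ j : ℝ)| := by exact_mod_cast Int.one_le_abs hj
    _ ≤ ∑ i, |(ℓ i : ℝ)| :=
      Finset.single_le_sum (f := fun i => |(ℓ i : ℝ)|) (fun i _ => abs_nonneg _)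
        (Finset.mem_univ j)

/-- A pointwise bound `‖f_ℓ‖ ≤ C ⟨ℓ⟩^τ ‖g_ℓ‖` yields `‖f‖_s ≤ C ‖g‖_{s+τ}`. -/
theorem sobNorm_le_of_norm_le {d : ℕ} {X Y : Type*} [NormedAddCommGroup X]
    [NormedAddCommGroup Y] {f : (Fin d → ℤ) → X} {g : (Fin d → ℤ) → Y} {C τ : ℝ} (s : ℝ)
    (hC : 0 ≤ C) (h : ∀ ℓ, ‖f ℓ‖ ≤ C * zbracket ℓ ^ τ * ‖g ℓ‖) :
    sobNorm d s f ≤ ENNReal.ofReal C * sobNorm d (s + τ) g := by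
  have key : ∀ ℓ, ENNReal.ofReal (zbracket ℓ ^ (2 * s) * ‖f ℓ‖ ^ 2) ≤
      ENNReal.ofReal C ^ (2 : ℝ) *
        ENNReal.ofReal (zbracket ℓ ^ (2 * (s + τ)) * ‖g ℓ‖ ^ 2) := by
    intro ℓ
    have hz : 0 < zbracket ℓ := one_pos.trans_le (le_max_left _ _)
    rw [ENNReal.rpow_two, ← ENNReal.ofReal_pow hC, ← ENNReal.ofReal_mul (by positivity)]
    apply ENNReal.ofReal_le_ofReal
    have hpow : zbracket ℓ ^ (2 * (s + τ)) = zbracket ℓ ^ (2 * s) * (zbracket ℓ ^ τ) ^ 2 := by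
      rw [mul_add, Real.rpow_add hz, mul_comm 2 τ, Real.rpow_mul hz.le τ, Real.rpow_two]
    calc zbracket ℓ ^ (2 * s) * ‖f ℓ‖ ^ 2
        ≤ zbracket ℓ ^ (2 * s) * (C * zbracket ℓ ^ τ * ‖g ℓ‖) ^ 2 := by
          gcongr
          exact h ℓ
      _ = C ^ 2 * (zbracket ℓ ^ (2 * (s + τ)) * ‖g ℓ‖ ^ 2) := by
          rw [hpow]
          ring
  calc sobNorm d s f
      ≤ (∑' ℓ, ENNReal.ofReal C ^ (2 : ℝ) *
          ENNReal.ofReal (zbracket ℓ ^ (2 * (s + τ)) * ‖g ℓ‖ ^ 2)) ^ (1 / 2 : ℝ) :=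
        ENNReal.rpow_le_rpow (ENNReal.tsum_le_tsum key) (by norm_num)
    _ = ENNReal.ofReal C * sobNorm d (s + τ) g := by
        rw [ENNReal.tsum_mul_left, ENNReal.mul_rpow_of_nonneg _ _ (by norm_num),
          ← ENNReal.rpow_mul, sobNorm]
        norm_num

/-- for a `(γ,τ)`-diophantine `ω`, the solution `f` of
`ω·∂_φ f = g` (on the Fourier side, `f_ℓ = (i ω·ℓ)⁻¹ • g_ℓ` for `ℓ ≠ 0`, `f_0 = 0`)
satisfies `‖f‖_s ≤ γ⁻¹ ‖g‖_{s+τ}`. -/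
theorem stmt1 (d : ℕ) (hd : 1 ≤ d) (γ τ s : ℝ) (hγ : 0 < γ) (hτ : 0 ≤ τ)
    (X : Type u) [NormedAddCommGroup X] [NormedSpace ℂ X]
    (ω : Fin d → ℝ)
    (hdio : ∀ ℓ : Fin d → ℤ, ℓ ≠ 0 →
      γ / (∑ i, |(ℓ i : ℝ)|) ^ τ ≤ |∑ i, ω i * (ℓ i : ℝ)|)
    (g f : (Fin d → ℤ) → X)
    (hg0 : g 0 = 0)
    (hgfin : sobNorm d (s + τ) g < ⊤)
    (hf0 : f 0 = 0)
    (hf : ∀ ℓ : Fin d → ℤ, ℓ ≠ 0 →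
      f ℓ = (Complex.I * ((∑ i, ω i * (ℓ i : ℝ) : ℝ) : ℂ))⁻¹ • g ℓ) :
    sobNorm d s f ≤ ENNReal.ofReal γ⁻¹ * sobNorm d (s + τ) g := by
  refine sobNorm_le_of_norm_le s (inv_nonneg.mpr hγ.le) fun ℓ => ?_
  by_cases hℓ : ℓ = 0
  · simp [hℓ, hf0, hg0]
  have h1 := one_le_sum_abs hℓ
  have hz : zbracket ℓ = ∑ i, |(ℓ i : ℝ)| := max_eq_right h1
  have hpos : 0 < ∑ i, |(ℓ i : ℝ)| := one_pos.trans_le h1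
  have hinv : |∑ i, ω i * (ℓ i : ℝ)|⁻¹ ≤ γ⁻¹ * (∑ i, |(ℓ i : ℝ)|) ^ τ := by
    calc |∑ i, ω i * (ℓ i : ℝ)|⁻¹
        ≤ (γ / (∑ i, |(ℓ i : ℝ)|) ^ τ)⁻¹ := inv_anti₀ (by positivity) (hdio ℓ hℓ)
      _ = γ⁻¹ * (∑ i, |(ℓ i : ℝ)|) ^ τ := by rw [inv_div, div_eq_inv_mul]
  rw [hf ℓ hℓ, norm_smul, norm_inv, norm_mul, Complex.norm_I, one_mul, Complex.norm_real,
    Real.norm_eq_abs, hz]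
  gcongr
end

section
/- Let d ≥ 1, γ > 0, τ ≥ 0 and s ∈ ℝ, let X be a complex normed vector space, and let ω₁, ω₂ ∈ ℝ^d both be (γ, τ)-diophantine. Let g⁽¹⁾, g⁽²⁾ : ℤ^d → X satisfy g⁽¹⁾_0 = g⁽²⁾_0 = 0, ‖g⁽¹⁾ − g⁽²⁾‖_{s+τ} < ∞ and ‖g⁽²⁾‖_{s+2τ+1} < ∞. For a = 1, 2 define f⁽ᵃ⁾_0 := 0 and f⁽ᵃ⁾_ℓ := (i ω_a·ℓ)^{-1} • g⁽ᵃ⁾_ℓ for ℓ ≠ 0. Then ‖f⁽¹⁾ − f⁽²⁾‖_s ≤ γ^{-1} ‖g⁽¹⁾ − g⁽²⁾‖_{s+τ} + γ^{-2} (max_{1≤i≤d} |ω_{1,i} − ω_{2,i}|) ‖g⁽²⁾‖_{s+2τ+1}. -/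
open scoped ENNReal

universe u

/-- The Sobolev norm as an `ℓ²` norm of `[0,∞]`-valued weights. -/
theorem sobNorm_eq_tsum_rpow (d : ℕ) (s : ℝ) {X : Type*} [NormedAddCommGroup X]
    (c : (Fin d → ℤ) → X) :
    sobNorm d s c =
      (∑' ℓ, ENNReal.ofReal (zbracket ℓ ^ s * ‖c ℓ‖) ^ (2 : ℝ)) ^ (1 / 2 : ℝ) := by
  unfold sobNorm
  congr 1
  refine tsum_congr fun ℓ => ?_
  have hz : 0 ≤ zbracket ℓ := zero_le_one.trans (le_max_left _ _)
  rw [ENNReal.ofReal_rpow_of_nonneg (mul_nonneg (Real.rpow_nonneg hz s) (norm_nonneg _)) zero_le_two,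
    Real.mul_rpow (Real.rpow_nonneg hz s) (norm_nonneg _), ← Real.rpow_mul hz, mul_comm s 2,
    Real.rpow_two]

/-- Minkowski's inequality for infinite sums in `[0,∞]`. -/
theorem ENNReal.Lp_add_le_tsum_of_one_le {ι : Type*} (f g : ι → ℝ≥0∞) {p : ℝ} (hp : 1 ≤ p) :
    (∑' i, (f i + g i) ^ p) ^ (1 / p) ≤
      (∑' i, f i ^ p) ^ (1 / p) + (∑' i, g i ^ p) ^ (1 / p) := by
  have hp0 : 0 < p := zero_lt_one.trans_le hp
  rw [one_div, ENNReal.rpow_inv_le_iff hp0, ENNReal.tsum_eq_iSup_sum]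
  refine iSup_le fun t => ?_
  rw [← ENNReal.rpow_inv_le_iff hp0, ← one_div]
  refine (ENNReal.Lp_add_le t f g hp).trans ?_
  gcongr <;> exact ENNReal.sum_le_tsum t

/-- Constants factor out of an `ℓᵖ` norm in `[0,∞]`. -/
theorem ENNReal.tsum_const_mul_rpow {ι : Type*} (a : ℝ≥0∞) (f : ι → ℝ≥0∞) {p : ℝ} (hp : 0 < p) :
    (∑' i, (a * f i) ^ p) ^ (1 / p) = a * (∑' i, f i ^ p) ^ (1 / p) := by
  simp_rw [ENNReal.mul_rpow_of_nonneg _ _ hp.le]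
  rw [ENNReal.tsum_mul_left, ENNReal.mul_rpow_of_nonneg _ _ (by positivity), ← ENNReal.rpow_mul,
    mul_one_div_cancel hp.ne', ENNReal.rpow_one]

/-- A pointwise weighted bound gives a bound between Sobolev norms. -/
theorem sobNorm_le_of_pointwise (d : ℕ) (s t r : ℝ) {X : Type*} [NormedAddCommGroup X]
    (c u v : (Fin d → ℤ) → X) {A B : ℝ} (hA : 0 ≤ A) (hB : 0 ≤ B)
    (h : ∀ ℓ, zbracket ℓ ^ s * ‖c ℓ‖ ≤
      A * (zbracket ℓ ^ t * ‖u ℓ‖) + B * (zbracket ℓ ^ r * ‖v ℓ‖)) :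
    sobNorm d s c ≤ ENNReal.ofReal A * sobNorm d t u + ENNReal.ofReal B * sobNorm d r v := by
  simp only [sobNorm_eq_tsum_rpow]
  rw [← ENNReal.tsum_const_mul_rpow _ _ two_pos, ← ENNReal.tsum_const_mul_rpow _ _ two_pos]
  refine le_trans ?_ (ENNReal.Lp_add_le_tsum_of_one_le _ _ one_le_two)
  gcongr with ℓ
  rw [← ENNReal.ofReal_mul hA, ← ENNReal.ofReal_mul hB]
  exact (ENNReal.ofReal_le_ofReal (h ℓ)).trans ENNReal.ofReal_add_le

/-- A nonzero integer vector has `ℓ¹` norm at least one, so it equals its bracket. -/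
theorem zbracket_eq_sum_of_ne_zero {d : ℕ} {ℓ : Fin d → ℤ} (hℓ : ℓ ≠ 0) :
    zbracket ℓ = ∑ i, |(ℓ i : ℝ)| := by
  obtain ⟨j, hj⟩ := Function.ne_iff.mp hℓ
  refine max_eq_right (le_trans ?_
    (Finset.single_le_sum (fun i _ => abs_nonneg (ℓ i : ℝ)) (Finset.mem_univ j)))
  exact_mod_cast Int.one_le_abs hj

/-- The difference of two frequencies paired with `ℓ` is controlled by their sup distance. -/
theorem abs_sum_mul_sub_sum_mul_le {d : ℕ} (ω₁ ω₂ : Fin d → ℝ) (ℓ : Fin d → ℤ) :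
    |∑ i, ω₁ i * (ℓ i : ℝ) - ∑ i, ω₂ i * (ℓ i : ℝ)| ≤
      (⨆ i, |ω₁ i - ω₂ i|) * ∑ i, |(ℓ i : ℝ)| := by
  rw [← Finset.sum_sub_distrib, Finset.mul_sum]
  refine (Finset.abs_sum_le_sum_abs _ _).trans (Finset.sum_le_sum fun i _ => ?_)
  rw [← sub_mul, abs_mul]
  gcongr
  exact le_ciSup (f := fun i => |ω₁ i - ω₂ i|) (Set.finite_range _).bddAbove i

/-- Stability of division by `I * a` under perturbation of the divisor and of the vector. -/
theorem norm_inv_I_mul_smul_sub_le {X : Type*} [NormedAddCommGroup X] [NormedSpace ℂ X]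
    {a b : ℝ} (ha : a ≠ 0) (hb : b ≠ 0) (x y : X) :
    ‖(Complex.I * (a : ℂ))⁻¹ • x - (Complex.I * (b : ℂ))⁻¹ • y‖ ≤
      |a|⁻¹ * ‖x - y‖ + |a|⁻¹ * |b|⁻¹ * |a - b| * ‖y‖ := by
  have ha' : (a : ℂ) ≠ 0 := Complex.ofReal_ne_zero.mpr ha
  have hb' : (b : ℂ) ≠ 0 := Complex.ofReal_ne_zero.mpr hb
  have hsplit : (Complex.I * (a : ℂ))⁻¹ • x - (Complex.I * (b : ℂ))⁻¹ • y =
      (Complex.I * (a : ℂ))⁻¹ • (x - y) +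
        ((Complex.I * (a : ℂ))⁻¹ - (Complex.I * (b : ℂ))⁻¹) • y := by module
  have hdiff : (Complex.I * (a : ℂ))⁻¹ - (Complex.I * (b : ℂ))⁻¹ =
      Complex.I * (a : ℂ)⁻¹ * (b : ℂ)⁻¹ * ((a - b : ℝ) : ℂ) := by
    rw [mul_inv, mul_inv, Complex.inv_I]
    push_cast
    field_simp
    ring
  rw [hsplit]
  refine (norm_add_le _ _).trans (le_of_eq ?_)
  rw [norm_smul, norm_smul, hdiff]
  simp only [norm_mul, norm_inv, Complex.norm_I, Complex.norm_real, Real.norm_eq_abs, one_mul]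

/-- Lipschitz estimate in the frequency `ω` for the solution of
`ω·∂_φ f = g`:
`‖f⁽¹⁾ − f⁽²⁾‖_s ≤ γ⁻¹ ‖g⁽¹⁾ − g⁽²⁾‖_{s+τ} + γ⁻² (max_i |ω₁ᵢ − ω₂ᵢ|) ‖g⁽²⁾‖_{s+2τ+1}`. -/
theorem stmt2 (d : ℕ) (hd : 1 ≤ d) (γ τ s : ℝ) (hγ : 0 < γ) (hτ : 0 ≤ τ)
    (X : Type u) [NormedAddCommGroup X] [NormedSpace ℂ X]
    (ω₁ ω₂ : Fin d → ℝ)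
    (hdio₁ : ∀ ℓ : Fin d → ℤ, ℓ ≠ 0 →
      γ / (∑ i, |(ℓ i : ℝ)|) ^ τ ≤ |∑ i, ω₁ i * (ℓ i : ℝ)|)
    (hdio₂ : ∀ ℓ : Fin d → ℤ, ℓ ≠ 0 →
      γ / (∑ i, |(ℓ i : ℝ)|) ^ τ ≤ |∑ i, ω₂ i * (ℓ i : ℝ)|)
    (g₁ g₂ f₁ f₂ : (Fin d → ℤ) → X)
    (hg₁0 : g₁ 0 = 0) (hg₂0 : g₂ 0 = 0)
    (hgdiff : sobNorm d (s + τ) (fun ℓ => g₁ ℓ - g₂ ℓ) < ⊤)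
    (hg₂fin : sobNorm d (s + 2 * τ + 1) g₂ < ⊤)
    (hf₁0 : f₁ 0 = 0) (hf₂0 : f₂ 0 = 0)
    (hf₁ : ∀ ℓ : Fin d → ℤ, ℓ ≠ 0 →
      f₁ ℓ = (Complex.I * ((∑ i, ω₁ i * (ℓ i : ℝ) : ℝ) : ℂ))⁻¹ • g₁ ℓ)
    (hf₂ : ∀ ℓ : Fin d → ℤ, ℓ ≠ 0 →
      f₂ ℓ = (Complex.I * ((∑ i, ω₂ i * (ℓ i : ℝ) : ℝ) : ℂ))⁻¹ • g₂ ℓ) :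
    sobNorm d s (fun ℓ => f₁ ℓ - f₂ ℓ) ≤
      ENNReal.ofReal γ⁻¹ * sobNorm d (s + τ) (fun ℓ => g₁ ℓ - g₂ ℓ) +
        ENNReal.ofReal ((γ ^ 2)⁻¹ * ⨆ i : Fin d, |ω₁ i - ω₂ i|) *
          sobNorm d (s + 2 * τ + 1) g₂ := by
  have hM : 0 ≤ ⨆ i, |ω₁ i - ω₂ i| := Real.iSup_nonneg fun i => abs_nonneg _
  refine sobNorm_le_of_pointwise d _ _ _ _ _ _ (by positivity) (by positivity) fun ℓ => ?_
  by_cases hℓ : ℓ = 0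
  · simp [hℓ, hf₁0, hf₂0, hg₁0, hg₂0]
  have hz : 0 < zbracket ℓ := zero_lt_one.trans_le (le_max_left _ _)
  have h₁ := hdio₁ ℓ hℓ
  have h₂ := hdio₂ ℓ hℓ
  have hab := abs_sum_mul_sub_sum_mul_le ω₁ ω₂ ℓ
  rw [hf₁ ℓ hℓ, hf₂ ℓ hℓ]
  rw [← zbracket_eq_sum_of_ne_zero hℓ] at h₁ h₂ hab
  set a := ∑ i, ω₁ i * (ℓ i : ℝ)
  set b := ∑ i, ω₂ i * (ℓ i : ℝ)
  set z := zbracket ℓ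
  set M := ⨆ i, |ω₁ i - ω₂ i|
  have hpos : 0 < γ / z ^ τ := by positivity
  have ha : |a|⁻¹ ≤ γ⁻¹ * z ^ τ := (inv_anti₀ hpos h₁).trans_eq (by rw [inv_div]; ring)
  have hb : |b|⁻¹ ≤ γ⁻¹ * z ^ τ := (inv_anti₀ hpos h₂).trans_eq (by rw [inv_div]; ring)
  calc z ^ s * ‖(Complex.I * (a : ℂ))⁻¹ • g₁ ℓ - (Complex.I * (b : ℂ))⁻¹ • g₂ ℓ‖
      ≤ z ^ s * (|a|⁻¹ * ‖g₁ ℓ - g₂ ℓ‖ + |a|⁻¹ * |b|⁻¹ * |a - b| * ‖g₂ ℓ‖) := by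
        gcongr
        exact norm_inv_I_mul_smul_sub_le (abs_pos.mp (hpos.trans_le h₁))
          (abs_pos.mp (hpos.trans_le h₂)) _ _
    _ ≤ z ^ s * (γ⁻¹ * z ^ τ * ‖g₁ ℓ - g₂ ℓ‖ +
          γ⁻¹ * z ^ τ * (γ⁻¹ * z ^ τ) * (M * z) * ‖g₂ ℓ‖) := by
        gcongr
    _ = _ := by
        rw [Real.rpow_add hz, Real.rpow_add hz, Real.rpow_add hz, two_mul, Real.rpow_add hz,
          Real.rpow_one]
        ring
end

section
/- Let d ≥ 1 and let n ≥ 1 and 0 ≤ k ≤ n be integers. There exists a constant C = C(d, k, n) > 0 such that for every Banach space X and every n-times continuously differentiable map u : ℝ^d → X all of whose derivatives of order ≤ n are bounded, one has ‖u‖_{C^k} ≤ C ‖u‖_{C^0}^{1−k/n} ‖u‖_{C^n}^{k/n}. -/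
universe u

/-- The `C^j` norm `∑_{i=0}^{j} sup_x ‖D^i u(x)‖` of a map `u : ℝ^d → X`. -/
noncomputable def cNorm (d : ℕ) {X : Type u} [NormedAddCommGroup X] [NormedSpace ℝ X]
    (j : ℕ) (u : EuclideanSpace ℝ (Fin d) → X) : ℝ :=
  ∑ i ∈ Finset.range (j + 1), ⨆ x, ‖iteratedFDeriv ℝ i u x‖

/-- A nonnegative number `m` with `m t ≤ 2 A + B t²` for every `t > 0` satisfies `m² ≤ 8 A B`. -/
theorem sq_le_of_forall_mul_le {A B m : ℝ} (hA : 0 ≤ A) (hB : 0 ≤ B) (hm : 0 ≤ m)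
    (h : ∀ t : ℝ, 0 < t → m * t ≤ 2 * A + B * t ^ 2) : m ^ 2 ≤ 8 * A * B := by
  have key : discrim B (-m) (2 * A) ≤ 0 := by
    refine discrim_le_zero fun t => ?_
    rcases le_or_gt t 0 with ht | ht
    · nlinarith [mul_nonneg hB (mul_self_nonneg t), mul_nonneg hm (neg_nonneg.2 ht)]
    · nlinarith [h t ht]
  rw [discrim] at key
  nlinarith

/-- Landau's inequality: `‖Df(x)‖² ≤ 8 A B` if `‖f‖ ≤ A` and `Df` is `B`-Lipschitz. -/
theorem norm_fderiv_sq_le {E F : Type*} [NormedAddCommGroup E] [NormedSpace ℝ E]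
    [NormedAddCommGroup F] [NormedSpace ℝ F] {f : E → F} (hf : Differentiable ℝ f) {A B : ℝ}
    (hB : 0 ≤ B) (hfA : ∀ x, ‖f x‖ ≤ A)
    (hfB : ∀ x y, ‖fderiv ℝ f y - fderiv ℝ f x‖ ≤ B * ‖y - x‖) (x : E) :
    ‖fderiv ℝ f x‖ ^ 2 ≤ 8 * A * B := by
  have hA : 0 ≤ A := (norm_nonneg _).trans (hfA x)
  have taylor (v : E) : ‖fderiv ℝ f x v‖ ≤ 2 * A + B * ‖v‖ ^ 2 := by
    have h := (convex_segment x (x + v)).norm_image_sub_le_of_norm_fderiv_le' (𝕜 := ℝ)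
      (f := f) (φ := fderiv ℝ f x) (C := B * ‖v‖) (fun y _ => hf y)
      (fun y hy => (hfB x y).trans (by
        gcongr
        simpa using norm_sub_le_of_mem_segment hy))
      (left_mem_segment ℝ x (x + v)) (right_mem_segment ℝ x (x + v))
    rw [add_sub_cancel_left] at h
    have h1 : fderiv ℝ f x v = f (x + v) - f x - (f (x + v) - f x - fderiv ℝ f x v) := by abel
    have h2 := norm_sub_le (f (x + v) - f x) (f (x + v) - f x - fderiv ℝ f x v)
    rw [← h1] at h2
    nlinarith [norm_sub_le (f (x + v)) (f x), hfA x, hfA (x + v)]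
  refine sq_le_of_forall_mul_le hA hB (norm_nonneg _) fun t ht => ?_
  have hop : ‖fderiv ℝ f x‖ ≤ (2 * A + B * t ^ 2) / t := by
    refine ContinuousLinearMap.opNorm_le_of_unit_norm (by positivity) fun w hw => ?_
    have h := taylor (t • w)
    rw [map_smul, norm_smul, norm_smul, hw, Real.norm_of_nonneg ht.le, mul_one] at h
    rw [le_div_iff₀ ht]
    linarith
  rwa [le_div_iff₀ ht] at hop

/-- Landau's inequality for three consecutive iterated derivatives. -/
theorem iSup_norm_iteratedFDeriv_succ_sq_le {E F : Type*} [NormedAddCommGroup E]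
    [NormedSpace ℝ E] [NormedAddCommGroup F] [NormedSpace ℝ F] {n j : ℕ} (hj : j + 2 ≤ n)
    {u : E → F} (hu : ContDiff ℝ n u)
    (hb : ∀ i : ℕ, i ≤ n → BddAbove (Set.range fun x => ‖iteratedFDeriv ℝ i u x‖)) :
    (⨆ x, ‖iteratedFDeriv ℝ (j + 1) u x‖) ^ 2 ≤
      8 * (⨆ x, ‖iteratedFDeriv ℝ j u x‖) * ⨆ x, ‖iteratedFDeriv ℝ (j + 2) u x‖ := by
  have hdiff (i : ℕ) (hi : i < n) : Differentiable ℝ (iteratedFDeriv ℝ i u) :=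
    hu.differentiable_iteratedFDeriv (by exact_mod_cast hi)
  have hB : 0 ≤ ⨆ x, ‖iteratedFDeriv ℝ (j + 2) u x‖ := Real.iSup_nonneg fun _ => norm_nonneg _
  have hA : 0 ≤ ⨆ x, ‖iteratedFDeriv ℝ j u x‖ := Real.iSup_nonneg fun _ => norm_nonneg _
  have hlip (x y : E) :
      ‖fderiv ℝ (iteratedFDeriv ℝ j u) y - fderiv ℝ (iteratedFDeriv ℝ j u) x‖ ≤
        (⨆ x, ‖iteratedFDeriv ℝ (j + 2) u x‖) * ‖y - x‖ := by
    have h := convex_univ.norm_image_sub_le_of_norm_fderiv_le (𝕜 := ℝ)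
      (f := iteratedFDeriv ℝ (j + 1) u) (fun z _ => hdiff (j + 1) (by omega) z)
      (fun z _ => norm_fderiv_iteratedFDeriv.trans_le (le_ciSup (hb (j + 2) hj) z))
      (Set.mem_univ x) (Set.mem_univ y)
    rwa [iteratedFDeriv_succ_eq_comp_left, Function.comp_apply, Function.comp_apply,
      ← dist_eq_norm, LinearIsometryEquiv.dist_map, dist_eq_norm] at h
  have hpt (x : E) : ‖iteratedFDeriv ℝ (j + 1) u x‖ ≤
      √(8 * (⨆ x, ‖iteratedFDeriv ℝ j u x‖) * ⨆ x, ‖iteratedFDeriv ℝ (j + 2) u x‖) := by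
    refine Real.le_sqrt_of_sq_le ?_
    rw [← norm_fderiv_iteratedFDeriv]
    exact norm_fderiv_sq_le (hdiff j (by omega)) hB (le_ciSup (hb j (by omega))) hlip x
  rw [← Real.sq_sqrt (by positivity :
    0 ≤ 8 * (⨆ x, ‖iteratedFDeriv ℝ j u x‖) * ⨆ x, ‖iteratedFDeriv ℝ (j + 2) u x‖)]
  exact pow_le_pow_left₀ (Real.iSup_nonneg fun _ => norm_nonneg _) (ciSup_le hpt) 2

/-- A convex finite sequence lies below the chord joining its end points. -/
theorem mul_le_chord_of_convex {n : ℕ} {g : ℕ → ℝ}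
    (hg : ∀ j, j + 2 ≤ n → 2 * g (j + 1) ≤ g j + g (j + 2)) {k : ℕ} (hk : k ≤ n) :
    n * g k ≤ (n - k) * g 0 + k * g n := by
  have hsucc (j : ℕ) : j + 1 ≤ n → (j + 1) * g j ≤ g 0 + j * g (j + 1) := by
    induction j with
    | zero => simp
    | succ j ih =>
      intro hj
      have h1 := ih (by omega)
      have h2 := mul_le_mul_of_nonneg_left (hg j hj) (by positivity : (0 : ℝ) ≤ j + 1)
      push_cast
      linarith
  have hle (m : ℕ) (hkm : k ≤ m) : m ≤ n → m * g k ≤ (m - k) * g 0 + k * g m := by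
    induction m, hkm using Nat.le_induction with
    | base => intro _; simp
    | succ m hkm ih =>
      intro hm
      rcases m.eq_zero_or_pos with rfl | hm0
      · obtain rfl : k = 0 := by omega
        simp
      · have hmpos : (0 : ℝ) < m := by exact_mod_cast hm0
        have h1 := mul_le_mul_of_nonneg_left (ih (by omega)) (by positivity : (0 : ℝ) ≤ m + 1)
        have h2 := mul_le_mul_of_nonneg_left (hsucc m hm) (Nat.cast_nonneg (α := ℝ) k)
        refine le_of_mul_le_mul_left ?_ hmpos
        push_cast
        linarith
  exact hle n hk le_rfl

/-- Interpolation for nondecreasing sequences that are log-convex up to a constant factor. -/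
theorem le_mul_rpow_of_sq_le {n k : ℕ} (hn : 1 ≤ n) (hk : k ≤ n) {a : ℕ → ℝ} {c : ℝ}
    (hmono : Monotone a) (h0 : 0 ≤ a 0)
    (ha : ∀ j, j + 2 ≤ n → a (j + 1) ^ 2 ≤ Real.exp c * a j * a (j + 2)) :
    a k ≤ Real.exp (c * k * (n - k) / 2) * a 0 ^ (1 - (k : ℝ) / n) * a n ^ ((k : ℝ) / n) := by
  have hn0 : (0 : ℝ) < n := by exact_mod_cast hn
  rcases hk.eq_or_lt with rfl | hkn
  · simp [div_self hn0.ne']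
  have hnonneg (j : ℕ) : 0 ≤ a j := h0.trans (hmono j.zero_le)
  rcases h0.eq_or_lt with h0 | h0
  · have hzero (j : ℕ) : j < n → a j = 0 := by
      induction j with
      | zero => exact fun _ => h0.symm
      | succ j ih =>
        intro hj
        have h := ha j hj
        rw [ih (by omega), mul_zero, zero_mul] at h
        exact pow_eq_zero_iff two_ne_zero |>.1 (le_antisymm h (sq_nonneg _))
    rw [hzero k hkn]
    exact mul_nonneg (mul_nonneg (Real.exp_pos _).le (Real.rpow_nonneg (hnonneg 0) _))
      (Real.rpow_nonneg (hnonneg n) _)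
  · have hpos (j : ℕ) : 0 < a j := h0.trans_le (hmono j.zero_le)
    have hconv := mul_le_chord_of_convex (n := n) (k := k)
      (g := fun j => Real.log (a j) + c * j ^ 2 / 2) (fun j hj => by
        have h := Real.log_le_log (pow_pos (hpos _) 2) (ha j hj)
        rw [Real.log_pow, Real.log_mul (by have := hpos j; positivity) (hpos _).ne',
          Real.log_mul (Real.exp_pos _).ne' (hpos _).ne', Real.log_exp] at h
        push_cast at h ⊢
        linarith) hk
    rw [Real.rpow_def_of_pos h0, Real.rpow_def_of_pos (hpos n), ← Real.exp_add, ← Real.exp_add,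
      ← Real.log_le_iff_le_exp (hpos k)]
    refine le_of_mul_le_mul_left ?_ hn0
    have hexpand : n * (c * k * (n - k) / 2 + Real.log (a 0) * (1 - (k : ℝ) / n) +
        Real.log (a n) * ((k : ℝ) / n)) =
        n * (c * k * (n - k) / 2) + (n - k) * Real.log (a 0) + k * Real.log (a n) := by
      field_simp
    rw [hexpand]
    push_cast at hconv
    linarith

/-- interpolation (Landau–Kolmogorov type) inequality for `C^k` norms:
`‖u‖_{C^k} ≤ C ‖u‖_{C^0}^{1−k/n} ‖u‖_{C^n}^{k/n}` for `C^n` maps `u : ℝ^d → X` with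
bounded derivatives of order `≤ n`. -/
theorem stmt5 (d n k : ℕ) (hd : 1 ≤ d) (hn : 1 ≤ n) (hk : k ≤ n) :
    ∃ C : ℝ, 0 < C ∧
      ∀ (X : Type u) [NormedAddCommGroup X] [NormedSpace ℝ X] [CompleteSpace X]
        (u : EuclideanSpace ℝ (Fin d) → X),
        ContDiff ℝ n u →
        (∀ i : ℕ, i ≤ n → BddAbove (Set.range fun x => ‖iteratedFDeriv ℝ i u x‖)) →
        cNorm d k u ≤ C * cNorm d 0 u ^ (1 - (k : ℝ) / n) * cNorm d n u ^ ((k : ℝ) / n) := by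
  refine ⟨Real.exp (Real.log 18 * k * (n - k) / 2), Real.exp_pos _, fun X _ _ _ u hu hb => ?_⟩
  have hM (i : ℕ) : 0 ≤ ⨆ x, ‖iteratedFDeriv ℝ i u x‖ := Real.iSup_nonneg fun _ => norm_nonneg _
  have hsucc (j : ℕ) : cNorm d (j + 1) u = cNorm d j u + ⨆ x, ‖iteratedFDeriv ℝ (j + 1) u x‖ :=
    Finset.sum_range_succ _ _
  have hmono : Monotone fun j => cNorm d j u :=
    monotone_nat_of_le_succ fun j => (hsucc j).symm ▸ le_add_of_nonneg_right (hM _)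
  have hle (j : ℕ) : ⨆ x, ‖iteratedFDeriv ℝ j u x‖ ≤ cNorm d j u :=
    Finset.single_le_sum (f := fun i => ⨆ x, ‖iteratedFDeriv ℝ i u x‖) (fun i _ => hM i)
      (Finset.self_mem_range_succ j)
  refine le_mul_rpow_of_sq_le hn hk hmono ((hM 0).trans (hle 0)) fun j hj => ?_
  have hj0 : 0 ≤ cNorm d j u := (hM j).trans (hle j)
  have hsq := iSup_norm_iteratedFDeriv_succ_sq_le hj hu hb
  have hprod := mul_le_mul (hle j) (hle (j + 2)) (hM _) hj0
  have hself := mul_le_mul_of_nonneg_left (hmono (by omega : j ≤ j + 2)) hj0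
  rw [Real.exp_log (by norm_num), hsucc j]
  simp only at hself
  nlinarith [sq_nonneg (cNorm d j u - ⨆ x, ‖iteratedFDeriv ℝ (j + 1) u x‖)]
end

section
/- Let d ≥ 1 and s₀ := ⌊d/2⌋ + 1. There exists a constant C₀ = C₀(d) ≥ 1 and, for each real s ≥ s₀, a constant C(s) ≥ C₀, such that the following tame product estimate holds for every normed ring X (a complete normed additive group with multiplication satisfying ‖x y‖ ≤ ‖x‖ ‖y‖): if u, v : ℤ^d → X satisfy ‖u‖_s < ∞ and ‖v‖_s < ∞, then for every ℓ ∈ ℤ^d the convolution series w_ℓ := ∑_{k ∈ ℤ^d} u_k v_{ℓ−k} converges absolutely, and ‖w‖_s ≤ C(s) ‖u‖_{s₀} ‖v‖_s + C₀ ‖u‖_s ‖v‖_{s₀}. -/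
open scoped ENNReal

universe u

/-- **Cauchy–Schwarz inequality** for series in `[0,∞]`. -/
theorem ENNReal.tsum_mul_le_l2 {ι : Type*} (f g : ι → ℝ≥0∞) :
    ∑' i, f i * g i ≤
      (∑' i, f i ^ (2 : ℝ)) ^ (1 / 2 : ℝ) * (∑' i, g i ^ (2 : ℝ)) ^ (1 / 2 : ℝ) := by
  let : MeasurableSpace ι := ⊤
  simpa only [MeasureTheory.lintegral_count, Pi.mul_apply] using
    ENNReal.lintegral_mul_le_Lp_mul_Lq (MeasureTheory.Measure.count (α := ι))
      Real.HolderConjugate.two_two (f := f) (g := g)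
      measurable_from_top.aemeasurable measurable_from_top.aemeasurable

/-- **Minkowski inequality** for series in `[0,∞]`. -/
theorem ENNReal.tsum_add_l2_le {ι : Type*} (f g : ι → ℝ≥0∞) :
    (∑' i, (f i + g i) ^ (2 : ℝ)) ^ (1 / 2 : ℝ) ≤
      (∑' i, f i ^ (2 : ℝ)) ^ (1 / 2 : ℝ) + (∑' i, g i ^ (2 : ℝ)) ^ (1 / 2 : ℝ) := by
  let : MeasurableSpace ι := ⊤
  simpa only [MeasureTheory.lintegral_count, Pi.add_apply] using
    ENNReal.lintegral_Lp_add_le (μ := MeasureTheory.Measure.count (α := ι))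
      (f := f) (g := g) (p := 2)
      measurable_from_top.aemeasurable measurable_from_top.aemeasurable one_le_two

theorem ENNReal.tsum_mul_left_l2 {ι : Type*} (c : ℝ≥0∞) (f : ι → ℝ≥0∞) :
    (∑' i, (c * f i) ^ (2 : ℝ)) ^ (1 / 2 : ℝ) = c * (∑' i, f i ^ (2 : ℝ)) ^ (1 / 2 : ℝ) := by
  simp_rw [ENNReal.mul_rpow_of_nonneg _ _ zero_le_two, ENNReal.tsum_mul_left]
  rw [ENNReal.mul_rpow_of_nonneg _ _ (by norm_num), ← ENNReal.rpow_mul]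
  norm_num

/-- **Young's inequality** `ℓ¹ * ℓ² ⊆ ℓ²` for convolutions. -/
theorem ENNReal.tsum_conv_l2_le {G : Type*} [AddCommGroup G] (a g : G → ℝ≥0∞) :
    (∑' l, (∑' k, a k * g (l - k)) ^ (2 : ℝ)) ^ (1 / 2 : ℝ) ≤
      (∑' k, a k) * (∑' k, g k ^ (2 : ℝ)) ^ (1 / 2 : ℝ) := by
  have half_sq (x : ℝ≥0∞) : (x ^ (1 / 2 : ℝ)) ^ (2 : ℝ) = x := by
    rw [← ENNReal.rpow_mul]; norm_num
  have sq_half (x : ℝ≥0∞) : (x ^ (2 : ℝ)) ^ (1 / 2 : ℝ) = x := by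
    rw [← ENNReal.rpow_mul]; norm_num
  have pointwise (l : G) : (∑' k, a k * g (l - k)) ^ (2 : ℝ) ≤
      (∑' k, a k) * ∑' k, a k * g (l - k) ^ (2 : ℝ) := by
    have split (k : G) :
        a k * g (l - k) = a k ^ (1 / 2 : ℝ) * (a k ^ (1 / 2 : ℝ) * g (l - k)) := by
      rw [← mul_assoc, ← ENNReal.rpow_add_of_nonneg _ _ (by norm_num) (by norm_num)]
      norm_num
    have cs := ENNReal.tsum_mul_le_l2 (fun k => a k ^ (1 / 2 : ℝ))
      (fun k => a k ^ (1 / 2 : ℝ) * g (l - k))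
    simp_rw [← split, ENNReal.mul_rpow_of_nonneg _ _ zero_le_two, half_sq] at cs
    rw [← ENNReal.mul_rpow_of_nonneg _ _ (by norm_num)] at cs
    simpa only [half_sq] using ENNReal.rpow_le_rpow cs zero_le_two
  calc (∑' l, (∑' k, a k * g (l - k)) ^ (2 : ℝ)) ^ (1 / 2 : ℝ)
      ≤ (∑' l, (∑' k, a k) * ∑' k, a k * g (l - k) ^ (2 : ℝ)) ^ (1 / 2 : ℝ) :=
        ENNReal.rpow_le_rpow (ENNReal.tsum_le_tsum pointwise) (by norm_num)
    _ = ((∑' k, a k) ^ (2 : ℝ) * ∑' k, g k ^ (2 : ℝ)) ^ (1 / 2 : ℝ) := by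
        have shift (k : G) : ∑' l, g (l - k) ^ (2 : ℝ) = ∑' l, g l ^ (2 : ℝ) :=
          (Equiv.subRight k).tsum_eq fun l => g l ^ (2 : ℝ)
        rw [ENNReal.tsum_mul_left, ENNReal.tsum_comm]
        simp_rw [ENNReal.tsum_mul_left, shift]
        rw [ENNReal.tsum_mul_right, ← mul_assoc, ENNReal.rpow_two, sq]
    _ = _ := by rw [ENNReal.mul_rpow_of_nonneg _ _ (by norm_num), sq_half]

theorem ENNReal.tsum_conv_comm {G : Type*} [AddCommGroup G] (a b : G → ℝ≥0∞) (l : G) :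
    ∑' k, a k * b (l - k) = ∑' k, b k * a (l - k) := by
  rw [← (Equiv.subLeft l).tsum_eq]
  simp [mul_comm]

theorem ENNReal.tsum_fin_pi_prod {α : Type*} (f : α → ℝ≥0∞) (d : ℕ) :
    ∑' x : Fin d → α, ∏ i, f (x i) = (∑' a, f a) ^ d := by
  induction d with
  | zero => simp
  | succ d ih =>
    rw [← (Fin.consEquiv fun _ : Fin (d + 1) => α).tsum_eq, ENNReal.tsum_prod']
    simp [Fin.prod_univ_succ, Fin.consEquiv, ENNReal.tsum_mul_left, ENNReal.tsum_mul_right, ih,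
      pow_succ']

theorem one_le_zbracket {d : ℕ} (l : Fin d → ℤ) : 1 ≤ zbracket l := le_max_left _ _

theorem zbracket_pos {d : ℕ} (l : Fin d → ℤ) : 0 < zbracket l :=
  one_pos.trans_le (one_le_zbracket l)

theorem zbracket_le_add {d : ℕ} (l k : Fin d → ℤ) :
    zbracket l ≤ zbracket k + zbracket (l - k) := by
  refine max_le (by linarith [one_le_zbracket k, one_le_zbracket (l - k)]) ?_
  refine le_trans ?_ (add_le_add (le_max_right _ _) (le_max_right _ _))
  rw [← Finset.sum_add_distrib]
  refine Finset.sum_le_sum fun i _ => ?_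
  simpa using abs_add_le (k i : ℝ) ((l i : ℝ) - k i)

theorem max_one_abs_le_zbracket {d : ℕ} (l : Fin d → ℤ) (i : Fin d) :
    max 1 |(l i : ℝ)| ≤ zbracket l :=
  max_le_max le_rfl
    (Finset.single_le_sum (f := fun i => |(l i : ℝ)|) (fun _ _ => abs_nonneg _)
      (Finset.mem_univ i))

theorem summable_max_one_abs_int_rpow {p : ℝ} (hp : 1 < p) :
    Summable fun n : ℤ => max 1 |(n : ℝ)| ^ (-p) := by
  refine ((Real.summable_abs_int_rpow hp).add
    (hasSum_ite_eq (0 : ℤ) (1 : ℝ)).summable).of_nonneg_of_le (fun n => by positivity) fun n => ?_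
  rcases eq_or_ne n 0 with rfl | hn
  · simp [Real.rpow_nonneg]
  · have : (1 : ℝ) ≤ |(n : ℝ)| := by exact_mod_cast Int.one_le_abs hn
    simp [hn, max_eq_right this]

theorem tsum_zbracket_rpow_lt_top {d : ℕ} (hd : 1 ≤ d) {r : ℝ} (hr : d < r) :
    ∑' l : Fin d → ℤ, ENNReal.ofReal (zbracket l ^ (-r)) < ⊤ := by
  have hd0 : (0 : ℝ) < d := by exact_mod_cast hd
  have bound (l : Fin d → ℤ) : ENNReal.ofReal (zbracket l ^ (-r)) ≤
      ∏ i, ENNReal.ofReal (max 1 |(l i : ℝ)| ^ (-(r / d))) := by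
    have hZ : zbracket l ^ (-r) = ∏ _i : Fin d, zbracket l ^ (-(r / d)) := by
      rw [Finset.prod_const, Finset.card_univ, Fintype.card_fin, ← Real.rpow_natCast,
        ← Real.rpow_mul (zbracket_pos l).le]
      field_simp
    rw [hZ, ← ENNReal.ofReal_prod_of_nonneg fun i _ => by positivity]
    refine ENNReal.ofReal_le_ofReal (Finset.prod_le_prod
      (fun i _ => Real.rpow_nonneg (zbracket_pos l).le _) fun i _ => ?_)
    refine Real.rpow_le_rpow_of_nonpos (by positivity) (max_one_abs_le_zbracket l i) ?_
    have : 0 < r / d := div_pos (hd0.trans hr) hd0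
    linarith
  refine (ENNReal.tsum_le_tsum bound).trans_lt ?_
  rw [ENNReal.tsum_fin_pi_prod fun n : ℤ => ENNReal.ofReal (max 1 |(n : ℝ)| ^ (-(r / d)))]
  refine ENNReal.pow_lt_top ?_
  exact (summable_max_one_abs_int_rpow ((one_lt_div hd0).2 hr)).tsum_ofReal_lt_top

/-- The splitting inequality behind the tame estimate: the constant in front of `y ^ s` does not
depend on `s`. -/
theorem Real.rpow_le_two_mul_rpow_add {x y z s : ℝ} (hx : 0 ≤ x) (hy : 0 ≤ y) (hz : 0 ≤ z)
    (hs : 0 < s) (h : x ≤ y + z) :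
    x ^ s ≤ 2 * y ^ s + ((1 - 2 ^ (-s⁻¹))⁻¹) ^ s * z ^ s := by
  set θ : ℝ := 2 ^ (-s⁻¹) with hθ
  have hθ0 : 0 < θ := by positivity
  have hθ1 : 0 < 1 - θ :=
    sub_pos.2 (Real.rpow_lt_one_of_one_lt_of_neg one_lt_two (by simpa using hs))
  have hθs : (θ⁻¹) ^ s = 2 := by
    rw [hθ, ← Real.rpow_neg zero_le_two, neg_neg, ← Real.rpow_mul zero_le_two,
      inv_mul_cancel₀ hs.ne', Real.rpow_one]
  have hK : 0 ≤ (1 - θ)⁻¹ := by positivity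
  rcases le_total (θ * x) y with hxy | hxy
  · have : x ^ s ≤ (θ⁻¹ * y) ^ s := by
      gcongr
      rwa [le_inv_mul_iff₀ hθ0]
    rw [Real.mul_rpow (by positivity) hy, hθs] at this
    have : 0 ≤ ((1 - θ)⁻¹) ^ s * z ^ s := by positivity
    linarith
  · have : x ^ s ≤ ((1 - θ)⁻¹ * z) ^ s := by
      gcongr
      rw [le_inv_mul_iff₀ hθ1]
      linarith
    rw [Real.mul_rpow hK hz] at this
    have : 0 ≤ 2 * y ^ s := by positivity
    linarith

theorem sobNorm_eq {d : ℕ} (s : ℝ) {X : Type*} [NormedAddCommGroup X] (c : (Fin d → ℤ) → X) :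
    sobNorm d s c =
      (∑' l, (ENNReal.ofReal (zbracket l ^ s) * ‖c l‖ₑ) ^ (2 : ℝ)) ^ (1 / 2 : ℝ) := by
  unfold sobNorm
  congr 2 with l
  have hZ := (zbracket_pos l).le
  rw [← ofReal_norm, ← ENNReal.ofReal_mul (by positivity), ENNReal.rpow_two,
    ← ENNReal.ofReal_pow (by positivity), mul_pow, ← Real.rpow_mul_natCast hZ]
  norm_num [mul_comm]

theorem sobNorm_mono {d : ℕ} {s t : ℝ} (h : s ≤ t) {X : Type*} [NormedAddCommGroup X]
    (c : (Fin d → ℤ) → X) : sobNorm d s c ≤ sobNorm d t c := by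
  unfold sobNorm
  gcongr with l
  exact one_le_zbracket l

theorem tsum_enorm_le_sobNorm {d : ℕ} (s : ℝ) {X : Type*} [NormedAddCommGroup X]
    (c : (Fin d → ℤ) → X) :
    ∑' l, ‖c l‖ₑ ≤
      (∑' l : Fin d → ℤ, ENNReal.ofReal (zbracket l ^ (-(2 * s)))) ^ (1 / 2 : ℝ) *
        sobNorm d s c := by
  have cs := ENNReal.tsum_mul_le_l2 (fun l : Fin d → ℤ => ENNReal.ofReal (zbracket l ^ (-s)))
    fun l => ENNReal.ofReal (zbracket l ^ s) * ‖c l‖ₑ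
  rw [← sobNorm_eq] at cs
  have cancel (l : Fin d → ℤ) : ENNReal.ofReal (zbracket l ^ (-s)) *
      (ENNReal.ofReal (zbracket l ^ s) * ‖c l‖ₑ) = ‖c l‖ₑ := by
    rw [← mul_assoc, ← ENNReal.ofReal_mul (Real.rpow_nonneg (zbracket_pos l).le _),
      ← Real.rpow_add (zbracket_pos l)]
    simp
  have square (l : Fin d → ℤ) : ENNReal.ofReal (zbracket l ^ (-s)) ^ (2 : ℝ) =
      ENNReal.ofReal (zbracket l ^ (-(2 * s))) := by
    rw [ENNReal.ofReal_rpow_of_nonneg (Real.rpow_nonneg (zbracket_pos l).le _) zero_le_two,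
      ← Real.rpow_mul (zbracket_pos l).le]
    ring_nf
  simpa only [cancel, square] using cs

theorem enorm_mul_le_mul_enorm {X : Type*} [NonUnitalNormedRing X] (x y : X) :
    ‖x * y‖ₑ ≤ ‖x‖ₑ * ‖y‖ₑ := by
  simpa only [enorm_eq_nnnorm, ← ENNReal.coe_mul, ENNReal.coe_le_coe] using nnnorm_mul_le x y

theorem sobNorm_conv_le {d : ℕ} {s : ℝ} (hs : 0 < s) {X : Type*} [NonUnitalNormedRing X]
    (u v : (Fin d → ℤ) → X) :
    sobNorm d s (fun l => ∑' k, u k * v (l - k)) ≤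
      ENNReal.ofReal (((1 - 2 ^ (-s⁻¹))⁻¹) ^ s) * ((∑' k, ‖u k‖ₑ) * sobNorm d s v) +
        2 * ((∑' k, ‖v k‖ₑ) * sobNorm d s u) := by
  set K : ℝ := ((1 - 2 ^ (-s⁻¹))⁻¹) ^ s with hK
  let W (l : Fin d → ℤ) : ℝ≥0∞ := ENNReal.ofReal (zbracket l ^ s)
  have weight (l k : Fin d → ℤ) : W l ≤ 2 * W k + ENNReal.ofReal K * W (l - k) := by
    have hθ : (2 : ℝ) ^ (-s⁻¹) ≤ 1 :=
      Real.rpow_le_one_of_one_le_of_nonpos one_le_two (by simpa using hs.le)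
    have hK0 : 0 ≤ K := Real.rpow_nonneg (inv_nonneg.2 (sub_nonneg.2 hθ)) _
    have hk := Real.rpow_nonneg (zbracket_pos k).le s
    have hlk := Real.rpow_nonneg (zbracket_pos (l - k)).le s
    rw [← ENNReal.ofReal_ofNat 2, ← ENNReal.ofReal_mul zero_le_two, ← ENNReal.ofReal_mul hK0,
      ← ENNReal.ofReal_add (by positivity) (by positivity)]
    exact ENNReal.ofReal_le_ofReal (Real.rpow_le_two_mul_rpow_add (zbracket_pos l).le
      (zbracket_pos k).le (zbracket_pos _).le hs (zbracket_le_add l k))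
  have pointwise (l : Fin d → ℤ) : W l * ‖∑' k, u k * v (l - k)‖ₑ ≤
      ENNReal.ofReal K * (∑' k, ‖u k‖ₑ * (W (l - k) * ‖v (l - k)‖ₑ)) +
        2 * ∑' k, ‖v k‖ₑ * (W (l - k) * ‖u (l - k)‖ₑ) := by
    rw [ENNReal.tsum_conv_comm (fun k => ‖v k‖ₑ) fun k => W k * ‖u k‖ₑ]
    simp_rw [← ENNReal.tsum_mul_left, ← ENNReal.tsum_add]
    calc W l * ‖∑' k, u k * v (l - k)‖ₑ
        ≤ W l * ∑' k, ‖u k‖ₑ * ‖v (l - k)‖ₑ := by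
          gcongr
          exact enorm_tsum_le_tsum_enorm.trans
            (ENNReal.tsum_le_tsum fun k => enorm_mul_le_mul_enorm _ _)
      _ = ∑' k, W l * (‖u k‖ₑ * ‖v (l - k)‖ₑ) := ENNReal.tsum_mul_left.symm
      _ ≤ _ := ENNReal.tsum_le_tsum fun k => by
          refine (mul_le_mul_left (weight l k) _).trans_eq ?_
          ring
  rw [sobNorm_eq]
  refine (ENNReal.rpow_le_rpow (ENNReal.tsum_le_tsum fun l =>
    ENNReal.rpow_le_rpow (pointwise l) zero_le_two) (by norm_num)).trans ?_
  refine (ENNReal.tsum_add_l2_le _ _).trans ?_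
  rw [ENNReal.tsum_mul_left_l2, ENNReal.tsum_mul_left_l2, sobNorm_eq, sobNorm_eq]
  gcongr
  · exact ENNReal.tsum_conv_l2_le (fun k => ‖u k‖ₑ) fun k => W k * ‖v k‖ₑ
  · exact ENNReal.tsum_conv_l2_le (fun k => ‖v k‖ₑ) fun k => W k * ‖u k‖ₑ

theorem summable_norm_conv {G X : Type*} [AddCommGroup G] [NonUnitalNormedRing X] {u v : G → X}
    (hu : ∑' k, ‖u k‖ₑ < ⊤) (hv : ∑' k, ‖v k‖ₑ < ⊤) (l : G) :
    Summable fun k => ‖u k * v (l - k)‖ := by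
  have bound : ∑' k, ‖u k * v (l - k)‖ₑ ≤ (∑' k, ‖u k‖ₑ) * ∑' k, ‖v k‖ₑ := by
    rw [← ENNReal.tsum_mul_right]
    refine ENNReal.tsum_le_tsum fun k => (enorm_mul_le_mul_enorm _ _).trans ?_
    gcongr
    exact ENNReal.le_tsum (f := fun k => ‖v k‖ₑ) (l - k)
  simpa using ENNReal.summable_toReal (bound.trans_lt (ENNReal.mul_lt_top hu hv)).ne

/-- tame estimate for products, with `s₀ = ⌊d/2⌋ + 1`: for a normed
ring `X`, the convolution `w_ℓ = ∑_k u_k v_{ℓ−k}` of `u, v` with finite `H^s` norm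
converges absolutely and `‖w‖_s ≤ C(s) ‖u‖_{s₀} ‖v‖_s + C₀ ‖u‖_s ‖v‖_{s₀}`. -/
theorem stmt6 (d : ℕ) (hd : 1 ≤ d) :
    ∃ C₀ : ℝ, 1 ≤ C₀ ∧ ∃ C : ℝ → ℝ,
      ∀ s : ℝ, ((d / 2 : ℕ) : ℝ) + 1 ≤ s →
        C₀ ≤ C s ∧
        ∀ (X : Type u) [NonUnitalNormedRing X] [CompleteSpace X]
          (u v : (Fin d → ℤ) → X),
          sobNorm d s u < ⊤ → sobNorm d s v < ⊤ →
          (∀ ℓ : Fin d → ℤ, Summable fun k : Fin d → ℤ => ‖u k * v (ℓ - k)‖) ∧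
          sobNorm d s (fun ℓ => ∑' k : Fin d → ℤ, u k * v (ℓ - k)) ≤
            ENNReal.ofReal (C s) * sobNorm d (((d / 2 : ℕ) : ℝ) + 1) u * sobNorm d s v +
              ENNReal.ofReal C₀ * sobNorm d s u * sobNorm d (((d / 2 : ℕ) : ℝ) + 1) v := by
  set s₀ : ℝ := ((d / 2 : ℕ) : ℝ) + 1 with hs₀
  have hs₀_pos : 0 < s₀ := by positivity
  have hds₀ : (d : ℝ) < 2 * s₀ := by
    have : d < 2 * (d / 2 + 1) := by omega
    rw [hs₀]
    exact_mod_cast this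
  set S : ℝ≥0∞ :=
    (∑' l : Fin d → ℤ, ENNReal.ofReal (zbracket l ^ (-(2 * s₀)))) ^ (1 / 2 : ℝ) with hS
  have hS_top : S < ⊤ :=
    ENNReal.rpow_lt_top_of_nonneg (by norm_num) (tsum_zbracket_rpow_lt_top hd hds₀).ne
  set K : ℝ → ℝ := fun s => ((1 - 2 ^ (-s⁻¹))⁻¹) ^ s with hK
  set C₀ : ℝ := max 1 (2 * S.toReal) with hC₀
  refine ⟨C₀, le_max_left _ _, fun s => max C₀ (K s * S.toReal), fun s hs =>
    ⟨le_max_left _ _, fun X _ _ u v hu hv => ?_⟩⟩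
  have l1 (c : (Fin d → ℤ) → X) : ∑' k, ‖c k‖ₑ ≤ S * sobNorm d s₀ c :=
    tsum_enorm_le_sobNorm s₀ c
  have l1_lt_top {c : (Fin d → ℤ) → X} (hc : sobNorm d s c < ⊤) : ∑' k, ‖c k‖ₑ < ⊤ :=
    (l1 c).trans_lt (ENNReal.mul_lt_top hS_top ((sobNorm_mono hs c).trans_lt hc))
  refine ⟨summable_norm_conv (l1_lt_top hu) (l1_lt_top hv), ?_⟩
  have hKS : ENNReal.ofReal (K s) * S ≤ ENNReal.ofReal (max C₀ (K s * S.toReal)) := by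
    rw [← ENNReal.ofReal_toReal hS_top.ne, ← ENNReal.ofReal_mul' ENNReal.toReal_nonneg,
      ENNReal.toReal_ofReal ENNReal.toReal_nonneg]
    exact ENNReal.ofReal_le_ofReal (le_max_right _ _)
  have h2S : 2 * S ≤ ENNReal.ofReal C₀ := by
    rw [← ENNReal.ofReal_toReal hS_top.ne, ← ENNReal.ofReal_ofNat 2,
      ← ENNReal.ofReal_mul zero_le_two]
    exact ENNReal.ofReal_le_ofReal (le_max_right _ _)
  calc sobNorm d s (fun l => ∑' k, u k * v (l - k))
      ≤ ENNReal.ofReal (K s) * ((∑' k, ‖u k‖ₑ) * sobNorm d s v) +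
          2 * ((∑' k, ‖v k‖ₑ) * sobNorm d s u) := sobNorm_conv_le (hs₀_pos.trans_le hs) u v
    _ ≤ ENNReal.ofReal (K s) * ((S * sobNorm d s₀ u) * sobNorm d s v) +
          2 * ((S * sobNorm d s₀ v) * sobNorm d s u) := by
        gcongr
        · exact l1 u
        · exact l1 v
    _ = (ENNReal.ofReal (K s) * S) * sobNorm d s₀ u * sobNorm d s v +
          (2 * S) * sobNorm d s u * sobNorm d s₀ v := by ring
    _ ≤ _ := by gcongr
end

section
/- Let M be a (multiplicative) semigroup, let p, q : M → [0, ∞), and let K₀, K be constants with 1 ≤ K₀ ≤ K such that for all x, y ∈ M: p(x y) ≤ 2 K₀ p(x) p(y) and q(x y) ≤ K p(x) q(y) + K₀ q(x) p(y). Then for every x ∈ M and every integer n ≥ 1: p(xⁿ) ≤ (2 K₀)^{n−1} p(x)ⁿ and q(xⁿ) ≤ n (2 K₀ p(x))^{n−1} K q(x). -/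
universe u

/-- abstract estimate for powers in a semigroup from tame composition
estimates: if `p(xy) ≤ 2K₀ p(x)p(y)` and `q(xy) ≤ K p(x)q(y) + K₀ q(x)p(y)`, then
`p(xⁿ) ≤ (2K₀)^{n−1} p(x)ⁿ` and `q(xⁿ) ≤ n (2K₀ p(x))^{n−1} K q(x)` for `n ≥ 1`.
(Since a bare semigroup has no power operation, the powers `xⁿ` are encoded by a
function `pow` with `pow 1 = x` and `pow (n+1) = pow n * x`.) -/
theorem stmt8 (M : Type u) [Semigroup M] (p q : M → ℝ) (K₀ K : ℝ)
    (hK₀ : 1 ≤ K₀) (hK : K₀ ≤ K)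
    (hp0 : ∀ x, 0 ≤ p x) (hq0 : ∀ x, 0 ≤ q x)
    (hp : ∀ x y, p (x * y) ≤ 2 * K₀ * p x * p y)
    (hq : ∀ x y, q (x * y) ≤ K * p x * q y + K₀ * q x * p y)
    (x : M) (pow : ℕ → M) (hpow1 : pow 1 = x)
    (hpowS : ∀ n : ℕ, 1 ≤ n → pow (n + 1) = pow n * x) :
    ∀ n : ℕ, 1 ≤ n →
      p (pow n) ≤ (2 * K₀) ^ (n - 1) * p x ^ n ∧
      q (pow n) ≤ (n : ℝ) * (2 * K₀ * p x) ^ (n - 1) * K * q x := by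
  have hpx := hp0 x
  have hqx := hq0 x
  have hK_nonneg : 0 ≤ K := by linarith
  intro n hn
  induction n, hn using Nat.le_induction with
  | base =>
    rw [hpow1]
    refine ⟨by simp, ?_⟩
    simpa using le_mul_of_one_le_left hqx (hK₀.trans hK)
  | succ n hn ih =>
    obtain ⟨m, rfl⟩ := Nat.exists_eq_add_of_le' hn
    obtain ⟨ihp, ihq⟩ := ih
    simp only [Nat.add_sub_cancel] at ihp ihq ⊢
    rw [hpowS _ hn]
    constructor
    · calc p (pow (m + 1) * x) ≤ 2 * K₀ * p (pow (m + 1)) * p x := hp _ _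
        _ ≤ 2 * K₀ * ((2 * K₀) ^ m * p x ^ (m + 1)) * p x := by gcongr
        _ = (2 * K₀) ^ (m + 1) * p x ^ (m + 1 + 1) := by ring
    · have hcoef : 1 + ((m + 1 : ℕ) : ℝ) * K₀ ≤ ((m + 1 + 1 : ℕ) : ℝ) * (2 * K₀) := by
        push_cast
        nlinarith [mul_nonneg (Nat.cast_nonneg (α := ℝ) m) (zero_le_one.trans hK₀)]
      calc q (pow (m + 1) * x)
          ≤ K * p (pow (m + 1)) * q x + K₀ * q (pow (m + 1)) * p x := hq _ _
        _ ≤ K * ((2 * K₀) ^ m * p x ^ (m + 1)) * q x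
            + K₀ * (((m + 1 : ℕ) : ℝ) * (2 * K₀ * p x) ^ m * K * q x) * p x := by gcongr
        _ = (1 + ((m + 1 : ℕ) : ℝ) * K₀) * ((2 * K₀ * p x) ^ m * p x * K * q x) := by
            rw [mul_pow (2 * K₀)]; ring
        _ ≤ ((m + 1 + 1 : ℕ) : ℝ) * (2 * K₀) * ((2 * K₀ * p x) ^ m * p x * K * q x) := by gcongr
        _ = ((m + 1 + 1 : ℕ) : ℝ) * (2 * K₀ * p x) ^ (m + 1) * K * q x := by ring
end

section
/- Let σ' ≥ 2 be a real number. There exists a constant C = C(σ') > 0 such that for all q : ℤ → ℂ and h : ℤ → ℂ one has ∑_{j∈ℤ} ⟨j⟩^{2(σ'−1)} ( ∑_{j'∈ℤ} |⟨⟨j⟩⟩ − ⟨⟨j'⟩⟩| · |q_{j−j'}| · |h_{j'}| )² ≤ C ( ∑_{j∈ℤ} ⟨j⟩^{2σ'} |q_j|² ) ( ∑_{j∈ℤ} ⟨j⟩^{2(σ'−1)} |h_j|² ) (an inequality in [0, ∞]). In particular the commutator [⟨⟨D⟩⟩, Λ_q] of the Fourier multiplier ⟨⟨D⟩⟩ with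 multiplication by q, whose matrix entries are (⟨⟨j⟩⟩ − ⟨⟨j'⟩⟩) q_{j−j'}, is a bounded operator on H^{σ'−1}(𝕋₁, ℂ) with operator norm ≲ ‖q‖_{H^{σ'}}. -/
open scoped ENNReal

/-- `⟨j⟩ := max (1, |j|)` for `j ∈ ℤ`. -/
noncomputable def ibracket (j : ℤ) : ℝ := max 1 |(j : ℝ)|

/-- `⟨⟨j⟩⟩ := (1 + 4π²j²)^{1/2}`, the symbol of the Fourier multiplier `⟨⟨D⟩⟩`. -/
noncomputable def dbracket (j : ℤ) : ℝ := Real.sqrt (1 + 4 * Real.pi ^ 2 * (j : ℝ) ^ 2)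

theorem ibracket_one_le (j : ℤ) : 1 ≤ ibracket j := le_max_left _ _

theorem ibracket_pos (j : ℤ) : 0 < ibracket j := one_pos.trans_le (ibracket_one_le j)

theorem abs_le_ibracket (j : ℤ) : |(j : ℝ)| ≤ ibracket j := le_max_right _ _

theorem ibracket_add_le (j k : ℤ) : ibracket (j + k) ≤ ibracket j + ibracket k := by
  refine max_le ?_ ?_
  · linarith [ibracket_one_le j, ibracket_one_le k]
  · push_cast
    linarith [abs_add_le (j : ℝ) k, abs_le_ibracket j, abs_le_ibracket k]

theorem abs_dbracket_sub_le (j k : ℤ) :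
    |dbracket j - dbracket k| ≤ 2 * Real.pi * ibracket (j - k) := by
  have key : ∀ j k : ℤ, dbracket j ≤ dbracket k + 2 * Real.pi * |((j - k : ℤ) : ℝ)| := by
    intro j k
    have hk : |2 * Real.pi * (k : ℝ)| ≤ dbracket k :=
      Real.abs_le_sqrt (by nlinarith)
    have hsq : dbracket k ^ 2 = 1 + 4 * Real.pi ^ 2 * (k : ℝ) ^ 2 :=
      Real.sq_sqrt (by positivity)
    have h0 : 0 ≤ dbracket k := Real.sqrt_nonneg _
    refine Real.sqrt_le_iff.2 ⟨by positivity, ?_⟩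
    have hj : (j : ℝ) = k + ((j - k : ℤ) : ℝ) := by push_cast; ring
    rw [hj, add_sq (dbracket k), hsq, mul_pow _ |_|, sq_abs]
    have hmul : 2 * Real.pi * (k : ℝ) * ((j - k : ℤ) : ℝ) ≤ dbracket k * |((j - k : ℤ) : ℝ)| :=
      (le_abs_self _).trans (by rw [abs_mul]; gcongr)
    nlinarith [mul_le_mul_of_nonneg_left hmul Real.pi_pos.le]
  have hle : 2 * Real.pi * |((j - k : ℤ) : ℝ)| ≤ 2 * Real.pi * ibracket (j - k) := by
    gcongr
    exact abs_le_ibracket _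
  have hswap : |((k - j : ℤ) : ℝ)| = |((j - k : ℤ) : ℝ)| := by
    push_cast
    exact abs_sub_comm _ _
  have h2 := key k j
  rw [hswap] at h2
  exact abs_le.2 ⟨by linarith, by linarith [key j k]⟩

theorem summable_inv_ibracket_sq : Summable fun k : ℤ => (ibracket k ^ 2)⁻¹ := by
  have h := (Real.summable_one_div_int_pow (p := 2)).2 one_lt_two
  refine h.of_norm_bounded_eventually ?_
  rw [Filter.eventually_cofinite]
  refine (Set.finite_singleton (0 : ℤ)).subset fun k hk => ?_
  by_contra hk0
  refine hk ?_
  have hk' : 0 < |(k : ℝ)| := abs_pos.2 (by exact_mod_cast hk0)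
  have := ibracket_pos k
  rw [Real.norm_of_nonneg (by positivity), one_div, ← sq_abs (k : ℝ)]
  gcongr
  exact abs_le_ibracket k

/-- The weight that compares the product of two `H^s` weights with the weight of the sum of the
frequencies. -/
noncomputable def convWeight (s : ℝ) (j k : ℤ) : ℝ :=
  (ibracket (j + k) / (ibracket j * ibracket k)) ^ s

theorem convWeight_nonneg (s : ℝ) (j k : ℤ) : 0 ≤ convWeight s j k := by
  have := ibracket_pos j
  have := ibracket_pos k
  have := ibracket_pos (j + k)
  unfold convWeight
  positivity

theorem convWeight_mul (s : ℝ) (j k : ℤ) :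
    convWeight s j k * (ibracket j ^ s * ibracket k ^ s) = ibracket (j + k) ^ s := by
  have hj := ibracket_pos j
  have hk := ibracket_pos k
  have hjk := ibracket_pos (j + k)
  rw [convWeight, ← Real.mul_rpow hj.le hk.le, ← Real.mul_rpow (by positivity) (by positivity)]
  congr 1
  field_simp

theorem convWeight_sq_le {s : ℝ} (hs : 1 ≤ s) (j k : ℤ) :
    convWeight s j k ^ 2 ≤
      2 ^ (2 * s - 2) * 2 * ((ibracket j ^ 2)⁻¹ + (ibracket k ^ 2)⁻¹) := by
  have hj := ibracket_pos j
  have hk := ibracket_pos k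
  have hjk := ibracket_pos (j + k)
  set t := ibracket (j + k) / (ibracket j * ibracket k) with ht
  have ht0 : 0 < t := by positivity
  have hle : t ≤ (ibracket j)⁻¹ + (ibracket k)⁻¹ := by
    have : (ibracket j)⁻¹ + (ibracket k)⁻¹
        = (ibracket j + ibracket k) / (ibracket j * ibracket k) := by
      field_simp
      ring
    rw [this]
    exact div_le_div_of_nonneg_right (ibracket_add_le j k) (by positivity)
  have ht2 : t ≤ 2 := by
    linarith [inv_le_one_of_one_le₀ (ibracket_one_le j),
      inv_le_one_of_one_le₀ (ibracket_one_le k)]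
  have hsplit : convWeight s j k ^ 2 = t ^ (2 * s - 2) * t ^ 2 := by
    rw [convWeight, ← ht, ← Real.rpow_natCast (t ^ s), ← Real.rpow_mul ht0.le,
      ← Real.rpow_natCast t, ← Real.rpow_add ht0]
    congr 1
    push_cast
    ring
  have hpow : t ^ (2 * s - 2) ≤ 2 ^ (2 * s - 2) :=
    Real.rpow_le_rpow ht0.le ht2 (by linarith)
  rw [hsplit, mul_assoc]
  refine mul_le_mul hpow ?_ (by positivity) (by positivity)
  calc t ^ 2 ≤ ((ibracket j)⁻¹ + (ibracket k)⁻¹) ^ 2 := by gcongr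
    _ ≤ 2 * ((ibracket j)⁻¹ ^ 2 + (ibracket k)⁻¹ ^ 2) := add_sq_le
    _ = _ := by rw [inv_pow, inv_pow]

theorem tsum_convWeight_sq_le {s : ℝ} (hs : 1 ≤ s) (j : ℤ) :
    ∑' k : ℤ, ENNReal.ofReal (convWeight s (j - k) k) ^ 2 ≤
      ENNReal.ofReal (2 ^ (2 * s - 2) * 2 * (2 * ∑' k : ℤ, (ibracket k ^ 2)⁻¹)) := by
  have hsum := summable_inv_ibracket_sq
  have hshift : Summable fun k : ℤ => (ibracket (j - k) ^ 2)⁻¹ :=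
    (Equiv.subLeft j).summable_iff.2 hsum
  have hshift_eq : ∑' k : ℤ, (ibracket (j - k) ^ 2)⁻¹ = ∑' k : ℤ, (ibracket k ^ 2)⁻¹ :=
    (Equiv.subLeft j).tsum_eq fun k : ℤ => (ibracket k ^ 2)⁻¹
  have htot := (hshift.add hsum).mul_left ((2 : ℝ) ^ (2 * s - 2) * 2)
  calc ∑' k : ℤ, ENNReal.ofReal (convWeight s (j - k) k) ^ 2
      ≤ ∑' k : ℤ, ENNReal.ofReal
          (2 ^ (2 * s - 2) * 2 * ((ibracket (j - k) ^ 2)⁻¹ + (ibracket k ^ 2)⁻¹)) := by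
        refine ENNReal.tsum_le_tsum fun k => ?_
        rw [← ENNReal.ofReal_pow (convWeight_nonneg _ _ _)]
        exact ENNReal.ofReal_le_ofReal (convWeight_sq_le hs _ _)
    _ = _ := by
        rw [← ENNReal.ofReal_tsum_of_nonneg (fun k => by positivity) htot, tsum_mul_left,
          hshift.tsum_add hsum, hshift_eq, two_mul (∑' k : ℤ, (ibracket k ^ 2)⁻¹)]

theorem ENNReal.tsum_mul_sq_le {ι : Type*} (f g : ι → ℝ≥0∞) :
    (∑' i, f i * g i) ^ 2 ≤ (∑' i, f i ^ 2) * ∑' i, g i ^ 2 := by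
  let _ : MeasurableSpace ι := ⊤
  have h := ENNReal.lintegral_mul_le_Lp_mul_Lq (MeasureTheory.Measure.count (α := ι))
    Real.HolderConjugate.two_two (f := f) (g := g)
    measurable_from_top.aemeasurable measurable_from_top.aemeasurable
  simp only [MeasureTheory.lintegral_count, Pi.mul_apply, ENNReal.rpow_two] at h
  calc (∑' i, f i * g i) ^ 2
      ≤ ((∑' i, f i ^ 2) ^ (1 / 2 : ℝ) * (∑' i, g i ^ 2) ^ (1 / 2 : ℝ)) ^ 2 := by gcongr
    _ = _ := by
        rw [mul_pow, ← ENNReal.rpow_mul_natCast, ← ENNReal.rpow_mul_natCast]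
        norm_num

theorem ENNReal.tsum_tsum_sub_mul (a b : ℤ → ℝ≥0∞) :
    ∑' j, ∑' k, a (j - k) * b k = (∑' j, a j) * ∑' k, b k := by
  rw [ENNReal.tsum_comm, ← ENNReal.tsum_mul_left]
  refine tsum_congr fun k => ?_
  rw [ENNReal.tsum_mul_right]
  congr 1
  exact (Equiv.subRight k).tsum_eq a

theorem rpow_mul_abs_dbracket_sub_le (s : ℝ) {x y : ℝ} (hx : 0 ≤ x) (hy : 0 ≤ y) (j k : ℤ) :
    ibracket j ^ s * (|dbracket j - dbracket k| * x * y) ≤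
      convWeight s (j - k) k *
        (2 * Real.pi * (ibracket (j - k) ^ (s + 1) * x) * (ibracket k ^ s * y)) := by
  have hd := ibracket_pos (j - k)
  have hj := ibracket_pos j
  have h := convWeight_mul s (j - k) k
  rw [sub_add_cancel] at h
  calc ibracket j ^ s * (|dbracket j - dbracket k| * x * y)
      ≤ ibracket j ^ s * (2 * Real.pi * ibracket (j - k) * x * y) := by
        gcongr
        exact abs_dbracket_sub_le j k
    _ = _ := by
        rw [← h, Real.rpow_add hd, Real.rpow_one]
        ring

/-- commutator estimate: for `σ' ≥ 2` there is `C = C(σ') > 0` with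
`∑_j ⟨j⟩^{2(σ'−1)} (∑_{j'} |⟨⟨j⟩⟩ − ⟨⟨j'⟩⟩| |q_{j−j'}| |h_{j'}|)²
  ≤ C (∑_j ⟨j⟩^{2σ'} |q_j|²) (∑_j ⟨j⟩^{2(σ'−1)} |h_j|²)` in `[0,∞]`,
i.e. the commutator `[⟨⟨D⟩⟩, Λ_q]` is bounded on `H^{σ'−1}` with norm `≲ ‖q‖_{H^{σ'}}`. -/
theorem stmt9 (σ' : ℝ) (hσ : 2 ≤ σ') :
    ∃ C : ℝ, 0 < C ∧ ∀ q h : ℤ → ℂ,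
      ∑' j : ℤ, ENNReal.ofReal (ibracket j ^ (2 * (σ' - 1))) *
          (∑' j' : ℤ,
            ENNReal.ofReal (|dbracket j - dbracket j'| * ‖q (j - j')‖ * ‖h j'‖)) ^ 2
        ≤ ENNReal.ofReal C *
            (∑' j : ℤ, ENNReal.ofReal (ibracket j ^ (2 * σ') * ‖q j‖ ^ 2)) *
            (∑' j : ℤ, ENNReal.ofReal (ibracket j ^ (2 * (σ' - 1)) * ‖h j‖ ^ 2)) := by
  have hS : 0 < ∑' k : ℤ, (ibracket k ^ 2)⁻¹ :=
    summable_inv_ibracket_sq.tsum_pos (fun k => by positivity) 0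
      (by have := ibracket_pos 0; positivity)
  set K : ℝ := 2 ^ (2 * (σ' - 1) - 2) * 2 * (2 * ∑' k : ℤ, (ibracket k ^ 2)⁻¹)
  have hK0 : 0 < K := by positivity
  refine ⟨K * (2 * Real.pi) ^ 2, by positivity, fun q h => ?_⟩
  set A : ℤ → ℝ≥0∞ := fun j => ENNReal.ofReal (ibracket j ^ (2 * σ') * ‖q j‖ ^ 2) with hA
  set B : ℤ → ℝ≥0∞ := fun j => ENNReal.ofReal (ibracket j ^ (2 * (σ' - 1)) * ‖h j‖ ^ 2) with hB
  have hsq : ∀ (r : ℝ) (j : ℤ), ibracket j ^ (2 * r) = (ibracket j ^ r) ^ 2 := fun r j => by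
    rw [mul_comm, Real.rpow_mul (ibracket_pos j).le, Real.rpow_two]
  have hterm : ∀ j : ℤ, ENNReal.ofReal (ibracket j ^ (2 * (σ' - 1))) *
      (∑' k : ℤ, ENNReal.ofReal (|dbracket j - dbracket k| * ‖q (j - k)‖ * ‖h k‖)) ^ 2 ≤
      ENNReal.ofReal (K * (2 * Real.pi) ^ 2) * ∑' k : ℤ, A (j - k) * B k := by
    intro j
    have hj := ibracket_pos j
    let F : ℤ → ℝ := fun k => 2 * Real.pi * (ibracket (j - k) ^ σ' * ‖q (j - k)‖) *
      (ibracket k ^ (σ' - 1) * ‖h k‖)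
    have hF : ∀ k, ENNReal.ofReal (F k) ^ 2
        = ENNReal.ofReal ((2 * Real.pi) ^ 2) * (A (j - k) * B k) := by
      intro k
      have hd := ibracket_pos (j - k)
      have hk := ibracket_pos k
      rw [hA, hB, ← ENNReal.ofReal_pow (by positivity), ← ENNReal.ofReal_mul (by positivity),
        ← ENNReal.ofReal_mul (by positivity), hsq, hsq]
      congr 1
      ring
    calc ENNReal.ofReal (ibracket j ^ (2 * (σ' - 1))) *
          (∑' k : ℤ, ENNReal.ofReal (|dbracket j - dbracket k| * ‖q (j - k)‖ * ‖h k‖)) ^ 2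
        = (∑' k : ℤ, ENNReal.ofReal (ibracket j ^ (σ' - 1) *
            (|dbracket j - dbracket k| * ‖q (j - k)‖ * ‖h k‖))) ^ 2 := by
          rw [hsq, ENNReal.ofReal_pow (by positivity), ← mul_pow, ← ENNReal.tsum_mul_left]
          congr 2
          ext k
          exact (ENNReal.ofReal_mul (by positivity)).symm
      _ ≤ (∑' k : ℤ, ENNReal.ofReal (convWeight (σ' - 1) (j - k) k) *
            ENNReal.ofReal (F k)) ^ 2 := by
          gcongr with k
          rw [← ENNReal.ofReal_mul (convWeight_nonneg _ _ _)]
          refine ENNReal.ofReal_le_ofReal ?_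
          simpa only [sub_add_cancel] using
            rpow_mul_abs_dbracket_sub_le (σ' - 1) (norm_nonneg (q (j - k))) (norm_nonneg (h k)) j k
      _ ≤ (∑' k : ℤ, ENNReal.ofReal (convWeight (σ' - 1) (j - k) k) ^ 2) *
            ∑' k : ℤ, ENNReal.ofReal (F k) ^ 2 := ENNReal.tsum_mul_sq_le _ _
      _ ≤ ENNReal.ofReal K *
            (ENNReal.ofReal ((2 * Real.pi) ^ 2) * ∑' k : ℤ, A (j - k) * B k) := by
          rw [tsum_congr hF, ENNReal.tsum_mul_left]
          gcongr
          exact tsum_convWeight_sq_le (by linarith) j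
      _ = _ := by rw [← mul_assoc, ← ENNReal.ofReal_mul hK0.le]
  refine (ENNReal.tsum_le_tsum hterm).trans_eq ?_
  rw [ENNReal.tsum_mul_left, ENNReal.tsum_tsum_sub_mul, ← mul_assoc]
end

section
/- Let σ' ∈ ℝ and M ≥ 0, and let a : ℕ₊ × ℕ₊ → ℂ (entries a_{j,k} indexed by positive integers) be such that for every finitely supported h : ℕ₊ → ℂ one has ∑_{j ≥ 1} j^{2σ'} |∑_{k ≥ 1} a_{j,k} h_k|² ≤ M² ∑_{k ≥ 1} k^{2σ'} |h_k|². Then for every finitely supported h : ℕ₊ → ℂ one has ∑_{j ≥ 1} j^{2σ'} ( ∑_{k ≥ 1, k ≠ j} |a_{j,k}| |h_k| / |j − k| )² ≤ (π²/3) M² ∑_{k ≥ 1} k^{2σ'} |h_k|². -/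
open scoped ENNReal

lemma hasSum_int_inv_sq : HasSum (fun n : ℤ => 1 / (n : ℝ) ^ 2) (Real.pi ^ 2 / 3) := by
  have h := HasSum.of_nat_of_neg (f := fun n : ℤ => 1 / (n : ℝ) ^ 2)
    (by simpa using hasSum_zeta_two) (by simpa using hasSum_zeta_two)
  have hpi : Real.pi ^ 2 / 6 + Real.pi ^ 2 / 6 - 1 / ((0 : ℤ) : ℝ) ^ 2 = Real.pi ^ 2 / 3 := by
    norm_num
    ring
  exact hpi ▸ h

lemma sum_inv_sub_sq_le (s : Finset ℕ+) (j : ℕ+) :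
    ∑ k ∈ s, (1 / |((j : ℕ) : ℝ) - ((k : ℕ) : ℝ)|) ^ 2 ≤ Real.pi ^ 2 / 3 := by
  have hinj : Function.Injective fun k : ℕ+ => ((j : ℕ) : ℤ) - ((k : ℕ) : ℤ) := by
    intro k l hkl
    exact PNat.coe_injective (by simpa using hkl)
  have h := sum_le_hasSum (s.map ⟨_, hinj⟩) (fun n _ => by positivity) hasSum_int_inv_sq
  simpa [Finset.sum_map] using h

/-- The row estimate obtained from the Cauchy–Schwarz inequality. -/
lemma sq_sum_div_abs_sub_le (s : Finset ℕ+) (j : ℕ+) (f : ℕ+ → ℝ) :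
    (∑ k ∈ s, f k / |((j : ℕ) : ℝ) - ((k : ℕ) : ℝ)|) ^ 2
      ≤ Real.pi ^ 2 / 3 * ∑ k ∈ s, f k ^ 2 := by
  calc (∑ k ∈ s, f k / |((j : ℕ) : ℝ) - ((k : ℕ) : ℝ)|) ^ 2
      = (∑ k ∈ s, 1 / |((j : ℕ) : ℝ) - ((k : ℕ) : ℝ)| * f k) ^ 2 := by
        congr 1
        exact Finset.sum_congr rfl fun k _ => by ring
    _ ≤ (∑ k ∈ s, (1 / |((j : ℕ) : ℝ) - ((k : ℕ) : ℝ)|) ^ 2) * ∑ k ∈ s, f k ^ 2 :=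
        Finset.sum_mul_sq_le_sq_mul_sq s _ f
    _ ≤ _ := by
        gcongr
        exact sum_inv_sub_sq_le s j

/-- Schur-type estimate. If the matrix `(a_{j,k})_{j,k ≥ 1}` defines an
operator of norm at most `M` on the weighted `ℓ²` space with weights `j^{2σ'}`, then
the matrix with entries `|a_{j,k}| / |j − k|` (for `k ≠ j`) defines an operator of
norm at most `(π²/3)^{1/2} M` on the same space, in the sense of the quadratic form
estimates below for all finitely supported `h`. -/
theorem stmt15 (σ' M : ℝ) (hM : 0 ≤ M) (a : ℕ+ → ℕ+ → ℂ)
    (hbound : ∀ h : ℕ+ → ℂ, (Function.support h).Finite →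
      ∑' j : ℕ+, ENNReal.ofReal (((j : ℕ) : ℝ) ^ (2 * σ') * ‖∑' k : ℕ+, a j k * h k‖ ^ 2)
        ≤ ENNReal.ofReal (M ^ 2) *
            ∑' k : ℕ+, ENNReal.ofReal (((k : ℕ) : ℝ) ^ (2 * σ') * ‖h k‖ ^ 2)) :
    ∀ h : ℕ+ → ℂ, (Function.support h).Finite →
      ∑' j : ℕ+, ENNReal.ofReal (((j : ℕ) : ℝ) ^ (2 * σ') *
          (∑' k : ℕ+, if k = j then 0
            else ‖a j k‖ * ‖h k‖ / |((j : ℕ) : ℝ) - ((k : ℕ) : ℝ)|) ^ 2)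
        ≤ ENNReal.ofReal (Real.pi ^ 2 / 3 * M ^ 2) *
            ∑' k : ℕ+, ENNReal.ofReal (((k : ℕ) : ℝ) ^ (2 * σ') * ‖h k‖ ^ 2) := by
  intro h hh
  have hcol (k : ℕ+) : ∑' j : ℕ+, ENNReal.ofReal (((j : ℕ) : ℝ) ^ (2 * σ') * ‖a j k‖ ^ 2)
      ≤ ENNReal.ofReal (M ^ 2) * ENNReal.ofReal (((k : ℕ) : ℝ) ^ (2 * σ')) := by
    have hk := hbound (Pi.single k 1) ((Set.finite_singleton k).subset
      Pi.support_single_subset)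
    have h₁ (j : ℕ+) : ∑' l, a j l * (Pi.single k 1 : ℕ+ → ℂ) l = a j k := by
      rw [tsum_eq_single k fun l hl => by simp [hl]]
      simp
    have h₂ : ∑' l : ℕ+, ENNReal.ofReal
        (((l : ℕ) : ℝ) ^ (2 * σ') * ‖(Pi.single k 1 : ℕ+ → ℂ) l‖ ^ 2)
        = ENNReal.ofReal (((k : ℕ) : ℝ) ^ (2 * σ')) := by
      rw [tsum_eq_single k fun l hl => by simp [hl]]
      simp
    simpa only [h₁, h₂] using hk
  have hrow (j : ℕ+) : ENNReal.ofReal (((j : ℕ) : ℝ) ^ (2 * σ') *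
      (∑' k : ℕ+, if k = j then 0
        else ‖a j k‖ * ‖h k‖ / |((j : ℕ) : ℝ) - ((k : ℕ) : ℝ)|) ^ 2)
      ≤ ENNReal.ofReal (Real.pi ^ 2 / 3) * ∑' k : ℕ+, ENNReal.ofReal (‖h k‖ ^ 2) *
          ENNReal.ofReal (((j : ℕ) : ℝ) ^ (2 * σ') * ‖a j k‖ ^ 2) := by
    have hsum : (∑' k : ℕ+, if k = j then 0
        else ‖a j k‖ * ‖h k‖ / |((j : ℕ) : ℝ) - ((k : ℕ) : ℝ)|)
        = ∑ k ∈ hh.toFinset, ‖a j k‖ * ‖h k‖ / |((j : ℕ) : ℝ) - ((k : ℕ) : ℝ)| := by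
      rw [tsum_eq_sum (s := hh.toFinset) fun k hk => by
        have : h k = 0 := by simpa using hk
        simp [this]]
      refine Finset.sum_congr rfl fun k _ => ?_
      split_ifs with hkj
      · simp [hkj]
      · rfl
    rw [hsum]
    calc _ ≤ ENNReal.ofReal (Real.pi ^ 2 / 3 * ∑ k ∈ hh.toFinset,
          ‖h k‖ ^ 2 * (((j : ℕ) : ℝ) ^ (2 * σ') * ‖a j k‖ ^ 2)) := by
          apply ENNReal.ofReal_le_ofReal
          calc _ ≤ ((j : ℕ) : ℝ) ^ (2 * σ') * (Real.pi ^ 2 / 3 *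
                ∑ k ∈ hh.toFinset, (‖a j k‖ * ‖h k‖) ^ 2) := by
                gcongr
                exact sq_sum_div_abs_sub_le _ j _
            _ = _ := by
                simp only [Finset.mul_sum]
                exact Finset.sum_congr rfl fun k _ => by ring
      _ = ENNReal.ofReal (Real.pi ^ 2 / 3) * ∑ k ∈ hh.toFinset, ENNReal.ofReal (‖h k‖ ^ 2) *
          ENNReal.ofReal (((j : ℕ) : ℝ) ^ (2 * σ') * ‖a j k‖ ^ 2) := by
          rw [ENNReal.ofReal_mul (by positivity),
            ENNReal.ofReal_sum_of_nonneg fun k _ => by positivity]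
          simp only [ENNReal.ofReal_mul (sq_nonneg ‖h _‖)]
      _ ≤ _ := by
          gcongr
          exact ENNReal.sum_le_tsum _
  calc _ ≤ ∑' j : ℕ+, ENNReal.ofReal (Real.pi ^ 2 / 3) * ∑' k : ℕ+, ENNReal.ofReal (‖h k‖ ^ 2) *
          ENNReal.ofReal (((j : ℕ) : ℝ) ^ (2 * σ') * ‖a j k‖ ^ 2) := ENNReal.tsum_le_tsum hrow
    _ = ENNReal.ofReal (Real.pi ^ 2 / 3) * ∑' k : ℕ+, ENNReal.ofReal (‖h k‖ ^ 2) *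
          ∑' j : ℕ+, ENNReal.ofReal (((j : ℕ) : ℝ) ^ (2 * σ') * ‖a j k‖ ^ 2) := by
        rw [ENNReal.tsum_mul_left, ENNReal.tsum_comm]
        simp only [ENNReal.tsum_mul_left]
    _ ≤ ENNReal.ofReal (Real.pi ^ 2 / 3) * ∑' k : ℕ+, ENNReal.ofReal (‖h k‖ ^ 2) *
          (ENNReal.ofReal (M ^ 2) * ENNReal.ofReal (((k : ℕ) : ℝ) ^ (2 * σ'))) := by
        gcongr with k
        exact hcol k
    _ = _ := by
        rw [ENNReal.ofReal_mul (by positivity), mul_assoc,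
          ← ENNReal.tsum_mul_left (a := ENNReal.ofReal (M ^ 2))]
        refine congrArg _ (tsum_congr fun k => ?_)
        rw [ENNReal.ofReal_mul (by positivity)]
        ring
end
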